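/- Let k, p_1, …, p_k, r_1, …, r_k, q ≥ 1 and s ≥ 2 be integers, and let G = K_1 ⊕ ((p_1 K_{r_1} ∪ ⋯ ∪ p_k K_{r_k}) ∪ q(K_1 ⊕ (K_1 ∪ K_2)) ∪ s P_3). Then (x^2 + 4x + 2)^{s−1} divides the characteristic polynomial det(x·I − D(G)) in ℝ[x]; moreover, both real roots of x^2 + 4x + 2 are less than −1/2. -/

import Mathlib

open Polynomial SimpleGraph Sum

noncomputable section

/-- The distance matrix of a graph, with real entries. -/
def distMatrix {V : Type*} [Fintype V] (G : SimpleGraph V) : Matrix V V ℝ :=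
  Matrix.of fun u v => (G.dist u v : ℝ)

/-- The second largest distance eigenvalue: the eigenvalues of the distance matrix
(the roots of its characteristic polynomial, with multiplicity) are sorted in
increasing order, and we take the one at position `card V - 2`. -/
def lambda2 {V : Type*} [Fintype V] [DecidableEq V] (G : SimpleGraph V) : ℝ :=
  ((distMatrix G).charpoly.roots.sort (· ≤ ·)).getD (Fintype.card V - 2) 0

/-- The diameter of a finite graph. -/
def graphDiam {V : Type*} [Fintype V] (G : SimpleGraph V) : ℕ :=
  Finset.univ.sup fun p : V × V => G.dist p.1 p.2

/-- A graph is chordal if every cycle of length at least 4 has a chord. -/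
def IsChordal {V : Type*} (G : SimpleGraph V) : Prop :=
  ∀ (v : V) (c : G.Walk v v), c.IsCycle → 4 ≤ c.length →
    ∃ u w : V, u ∈ c.support ∧ w ∈ c.support ∧ G.Adj u w ∧ s(u, w) ∉ c.edges

/-- Ptolemaic graph: the Ptolemy inequality for the graph distance. -/
def IsPtolemaic {V : Type*} (G : SimpleGraph V) : Prop :=
  ∀ u v w x : V,
    G.dist u v * G.dist w x ≤ G.dist u w * G.dist v x + G.dist u x * G.dist v w

/-- `S` is a `uv`-separator: `u, v ∉ S` and every walk from `u` to `v` meets `S`. -/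
def IsUVSeparator {V : Type*} (G : SimpleGraph V) (S : Finset V) (u v : V) : Prop :=
  u ∉ S ∧ v ∉ S ∧ ∀ w : G.Walk u v, ∃ x ∈ w.support, x ∈ S

/-- `S` is a minimal vertex separator: a minimal `uv`-separator for some pair of
distinct non-adjacent vertices `u, v`. -/
def IsMinimalVertexSeparator {V : Type*} (G : SimpleGraph V) (S : Finset V) : Prop :=
  ∃ u v : V, u ≠ v ∧ ¬ G.Adj u v ∧ IsUVSeparator G S u v ∧
    ∀ T : Finset V, T ⊂ S → ¬ IsUVSeparator G T u v

/-- A connected component `K` of `G − S` is full if every vertex of `S` has a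
neighbour in `K`. -/
def IsFullComponent {V : Type*} (G : SimpleGraph V) (S : Finset V)
    (K : (G.induce ((S : Set V)ᶜ)).ConnectedComponent) : Prop :=
  ∀ a ∈ S, ∃ x : ((S : Set V)ᶜ : Set V),
    (G.induce ((S : Set V)ᶜ)).connectedComponentMk x = K ∧ G.Adj a ↑x

/-- The join `G ⊕ H` of two vertex-disjoint graphs. -/
def graphJoin {α β : Type*} (G : SimpleGraph α) (H : SimpleGraph β) :
    SimpleGraph (α ⊕ β) :=
  SimpleGraph.fromRel fun x y =>
    (∃ a b, x = Sum.inl a ∧ y = Sum.inl b ∧ G.Adj a b) ∨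
    (∃ a b, x = Sum.inr a ∧ y = Sum.inr b ∧ H.Adj a b) ∨
    (x.isLeft ∧ y.isRight)

/-- The disjoint union of two vertex-disjoint graphs. -/
def graphSum {α β : Type*} (G : SimpleGraph α) (H : SimpleGraph β) :
    SimpleGraph (α ⊕ β) :=
  SimpleGraph.fromRel fun x y =>
    (∃ a b, x = Sum.inl a ∧ y = Sum.inl b ∧ G.Adj a b) ∨
    (∃ a b, x = Sum.inr a ∧ y = Sum.inr b ∧ H.Adj a b)

/-- `p` disjoint copies of the complete graph `K_r`. -/
def cliqueCopies (p r : ℕ) : SimpleGraph (Fin p × Fin r) :=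
  SimpleGraph.fromRel fun x y => x.1 = y.1

/-- `q` disjoint copies of `K_1 ⊕ (K_1 ∪ K_2)` (the paw graph): in each copy,
vertex 0 is universal, vertex 1 is otherwise isolated, vertices 2,3 form a `K_2`. -/
def pawCopies (q : ℕ) : SimpleGraph (Fin q × Fin 4) :=
  SimpleGraph.fromRel fun x y => x.1 = y.1 ∧ (x.2 = 0 ∨ (x.2 = 2 ∧ y.2 = 3))

/-- `s` disjoint copies of the path `P_3`. -/
def path3Copies (s : ℕ) : SimpleGraph (Fin s × Fin 3) :=
  SimpleGraph.fromRel fun x y => x.1 = y.1 ∧ ((x.2 = 0 ∧ y.2 = 1) ∨ (x.2 = 1 ∧ y.2 = 2))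

/-- The disjoint union `p_1 K_{r_1} ∪ ⋯ ∪ p_k K_{r_k}`. -/
def multiCliques (k : ℕ) (p r : Fin k → ℕ) :
    SimpleGraph ((i : Fin k) × (Fin (p i) × Fin (r i))) :=
  SimpleGraph.fromRel fun x y =>
    (⟨x.1, x.2.1⟩ : (i : Fin k) × Fin (p i)) = ⟨y.1, y.2.1⟩

/-- The relaxed block star
`K_1 ⊕ ((p_1 K_{r_1} ∪ ⋯ ∪ p_k K_{r_k}) ∪ q (K_1 ⊕ (K_1 ∪ K_2)) ∪ s P_3)`. -/
def relaxedBlockStar (k : ℕ) (p r : Fin k → ℕ) (q s : ℕ) :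
    SimpleGraph (Unit ⊕ (((i : Fin k) × (Fin (p i) × Fin (r i))) ⊕
      ((Fin q × Fin 4) ⊕ (Fin s × Fin 3)))) :=
  graphJoin (⊤ : SimpleGraph Unit)
    (graphSum (multiCliques k p r) (graphSum (pawCopies q) (path3Copies s)))

/-- The graph `G(r,p,q) = K_1 ⊕ (p K_r ∪ q (K_1 ⊕ (K_1 ∪ K_2)))`. -/
def Grpq (r p q : ℕ) : SimpleGraph (Unit ⊕ ((Fin p × Fin r) ⊕ (Fin q × Fin 4))) :=
  graphJoin (⊤ : SimpleGraph Unit) (graphSum (cliqueCopies p r) (pawCopies q))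

/-- The full house graph `K_2 ⊕ (K_1 ∪ K_2)`: vertices 0,1 form the join-`K_2`,
vertex 2 is the `K_1`, vertices 3,4 form the `K_2`. -/
def fullHouse : SimpleGraph (Fin 5) :=
  SimpleGraph.fromRel fun x y => x = 0 ∨ x = 1 ∨ (x = 3 ∧ y = 4)

/-- The diamond graph: `K_4` minus an edge. -/
def diamondGraph : SimpleGraph (Fin 4) :=
  SimpleGraph.fromRel fun x y => x = 0 ∨ x = 1

/-- The path on four vertices. -/
def path4 : SimpleGraph (Fin 4) :=
  SimpleGraph.fromRel fun x y => (x : ℕ) + 1 = (y : ℕ)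

/-- The cycle on four vertices. -/
def cycle4 : SimpleGraph (Fin 4) :=
  SimpleGraph.fromRel fun x y => x + 1 = y

/-- The triple block graph `Pt_2(p,q)`: a full house (on `Fin 5`, with the
join-`K_2` being vertices `a = 0`, `b = 1`) together with `p - 1` further vertices
forming with `a` a clique `K_p` and `q - 1` further vertices forming with `b`
a clique `K_q`. -/
def Pt2Graph (p q : ℕ) : SimpleGraph (Fin 5 ⊕ (Fin (p - 1) ⊕ Fin (q - 1))) :=
  SimpleGraph.fromRel fun x y =>
    match x, y with
    | Sum.inl a, Sum.inl b => a = 0 ∨ a = 1 ∨ (a = 3 ∧ b = 4)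
    | Sum.inl a, Sum.inr (Sum.inl _) => a = 0
    | Sum.inl a, Sum.inr (Sum.inr _) => a = 1
    | Sum.inr (Sum.inl _), Sum.inr (Sum.inl _) => True
    | Sum.inr (Sum.inr _), Sum.inr (Sum.inr _) => True
    | _, _ => False

/-- The nine-vertex graph `Pt_1`: a full house (vertices 0,…,4, join-`K_2` being
`a = 0`, `b = 1`, `K_2` being 3,4), a vertex 5 adjacent only to `a`, a vertex 6
adjacent only to `b`, and vertices 7,8 adjacent to each other and to `b`. -/
def Pt1Graph : SimpleGraph (Fin 9) :=
  SimpleGraph.fromRel fun x y =>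
    (x = 0 ∧ (y = 1 ∨ y = 2 ∨ y = 3 ∨ y = 4 ∨ y = 5)) ∨
    (x = 1 ∧ (y = 2 ∨ y = 3 ∨ y = 4 ∨ y = 6 ∨ y = 7 ∨ y = 8)) ∨
    (x = 3 ∧ y = 4) ∨ (x = 7 ∧ y = 8)

/-- `G` contains an induced subgraph isomorphic to `H`. -/
def HasInducedSubgraph {V W : Type*} (G : SimpleGraph V) (H : SimpleGraph W) : Prop :=
  ∃ s : Set V, Nonempty ((G.induce s) ≃g H)

/-- `G` is isomorphic to a connected induced subgraph of `H`. -/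
def IsoToConnectedInducedSubgraph {V W : Type*} (G : SimpleGraph V)
    (H : SimpleGraph W) : Prop :=
  ∃ s : Set W, (H.induce s).Connected ∧ Nonempty (G ≃g (H.induce s))

/-- A vertex is simplicial if its neighbourhood is a clique. -/
def IsSimplicial {V : Type*} (G : SimpleGraph V) (v : V) : Prop :=
  G.IsClique (G.neighborSet v)

/-- The quintic polynomial `f(r,p,q,x)`. -/
def fpoly (r p q : ℕ) : Polynomial ℝ :=
  X ^ 5 - C (8 * (q : ℝ) + 2 * (r : ℝ) * (p : ℝ) - (r : ℝ) - 8) * X ^ 4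
    - C ((8 * (r : ℝ) + 36) * (q : ℝ) + 15 * (r : ℝ) * (p : ℝ) - 7 * (r : ℝ) - 20) * X ^ 3
    - C ((28 * (r : ℝ) + 52) * (q : ℝ) + 33 * (r : ℝ) * (p : ℝ) - 13 * (r : ℝ) - 18) * X ^ 2
    - C ((24 * (r : ℝ) + 30) * (q : ℝ) + 23 * (r : ℝ) * (p : ℝ) - 5 * (r : ℝ) - 5) * X
    - C ((6 * (r : ℝ) + 6) * (q : ℝ) + 5 * (r : ℝ) * (p : ℝ))

end

/-- A matrix intertwining `A` and `B` and admitting a left inverse yields a divisibility relation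
between the characteristic polynomials, up to a power of `X`. -/
theorem Matrix.charpoly_dvd_X_pow_mul_charpoly {R m n : Type*} [CommRing R]
    [Fintype m] [DecidableEq m] [Fintype n] [DecidableEq n]
    {A : Matrix n n R} {B : Matrix m m R} {P : Matrix n m R} {Q : Matrix m n R}
    (hAP : A * P = P * B) (hQP : Q * P = 1) :
    B.charpoly ∣ (X : R[X]) ^ Fintype.card m * A.charpoly := by
  have hprod : (A * (1 - P * Q)).charmatrix * (P * B * Q).charmatrix =
      (X : R[X]) • A.charmatrix := by
    have hA : A * (1 - P * Q) = A - P * B * Q := by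
      rw [mul_sub, mul_one, ← Matrix.mul_assoc, hAP]
    have hz : (A - P * B * Q) * (P * B * Q) = 0 := by
      calc (A - P * B * Q) * (P * B * Q) = (A * P) * B * Q - P * B * (Q * P) * B * Q := by
            simp only [Matrix.sub_mul, Matrix.mul_assoc]
        _ = 0 := by simp [hAP, hQP]
    have hz' := congrArg (C : R →+* R[X]).mapMatrix hz
    rw [map_mul, map_zero, map_sub] at hz'
    rw [hA]
    unfold Matrix.charmatrix
    rw [map_sub]
    simp only [← Matrix.smul_one_eq_diagonal, Matrix.scalar_apply]
    simp only [Matrix.mul_sub, Matrix.sub_mul, Matrix.smul_mul, Matrix.mul_smul,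
      Matrix.one_mul, Matrix.mul_one, smul_sub] at hz' ⊢
    rw [hz']
    abel
  have hdet := congrArg Matrix.det hprod
  rw [Matrix.det_mul, Matrix.det_smul] at hdet
  change (A * (1 - P * Q)).charpoly * (P * B * Q).charpoly = X ^ Fintype.card n * A.charpoly
    at hdet
  have hcomm := Matrix.charpoly_mul_comm' P (B * Q)
  rw [Matrix.mul_assoc, hQP, Matrix.mul_one, ← Matrix.mul_assoc] at hcomm
  refine ⟨(A * (1 - P * Q)).charpoly, (monic_X_pow (Fintype.card n)).isRegular.left ?_⟩
  simp only
  linear_combination (-X ^ Fintype.card m) * hdet + (A * (1 - P * Q)).charpoly * hcomm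

theorem Matrix.charpoly_blockDiagonal {R m o : Type*} [CommRing R] [Fintype m] [DecidableEq m]
    [Fintype o] [DecidableEq o] (M : o → Matrix m m R) :
    (Matrix.blockDiagonal M).charpoly = ∏ k, (M k).charpoly := by
  simp only [Matrix.charpoly]
  rw [← Matrix.det_blockDiagonal]
  congr 1
  ext ⟨i, k⟩ ⟨j, l⟩
  by_cases h : k = l
  · subst h
    by_cases hij : i = j <;> simp [Matrix.blockDiagonal_apply, hij]
  · simp [Matrix.blockDiagonal_apply, h]

theorem graphJoin_adj_inl_inr {α β : Type*} (G : SimpleGraph α) (H : SimpleGraph β)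
    (a : α) (b : β) : (graphJoin G H).Adj (Sum.inl a) (Sum.inr b) := by
  simp [graphJoin]

theorem graphJoin_adj_inr_inr {α β : Type*} (G : SimpleGraph α) (H : SimpleGraph β)
    (b b' : β) : (graphJoin G H).Adj (Sum.inr b) (Sum.inr b') ↔ H.Adj b b' := by
  simp only [graphJoin, SimpleGraph.fromRel_adj]
  have := H.adj_comm b b'
  have := @SimpleGraph.Adj.ne _ H b b'
  simp_all

theorem graphSum_not_adj_inl_inr {α β : Type*} (G : SimpleGraph α) (H : SimpleGraph β)
    (a : α) (b : β) : ¬ (graphSum G H).Adj (Sum.inl a) (Sum.inr b) := by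
  simp [graphSum]

theorem graphSum_adj_inr_inr {α β : Type*} (G : SimpleGraph α) (H : SimpleGraph β)
    (b b' : β) : (graphSum G H).Adj (Sum.inr b) (Sum.inr b') ↔ H.Adj b b' := by
  simp only [graphSum, SimpleGraph.fromRel_adj]
  have := H.adj_comm b b'
  have := @SimpleGraph.Adj.ne _ H b b'
  simp_all

theorem SimpleGraph.dist_eq_two_of_adj_of_adj {V : Type*} {G : SimpleGraph V} {u v w : V}
    (huw : G.Adj u w) (hwv : G.Adj w v) (hne : u ≠ v) (h : ¬ G.Adj u v) : G.dist u v = 2 := by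
  have hle : G.dist u v ≤ 2 := G.dist_le (.cons huw (.cons hwv .nil))
  have hpos : 0 < G.dist u v := (huw.reachable.trans hwv.reachable).pos_dist_of_ne hne
  have hone : G.dist u v ≠ 1 := fun h1 => h (SimpleGraph.dist_eq_one_iff_adj.mp h1)
  omega

/-- The distance matrix of `P_3`. -/
def path3Dist : Matrix (Fin 3) (Fin 3) ℝ := !![0, 1, 2; 1, 0, 1; 2, 1, 0]

theorem graphJoin_dist_inr_of_not_adj {β : Type*} (H : SimpleGraph β) {b b' : β}
    (hne : b ≠ b') (h : ¬ H.Adj b b') :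
    (graphJoin (⊤ : SimpleGraph Unit) H).dist (Sum.inr b) (Sum.inr b') = 2 :=
  SimpleGraph.dist_eq_two_of_adj_of_adj (graphJoin_adj_inl_inr _ H () b).symm
    (graphJoin_adj_inl_inr _ H () b') (by simpa using hne)
    (by rwa [graphJoin_adj_inr_inr])

theorem path3Copies_adj (s : ℕ) (i j : Fin s) (a b : Fin 3) :
    (path3Copies s).Adj (i, a) (j, b) ↔ i = j ∧ path3Dist a b = 1 := by
  simp only [path3Copies, SimpleGraph.fromRel_adj, path3Dist]
  fin_cases a <;> fin_cases b <;> simp [eq_comm]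

section RelaxedBlockStar

variable (k : ℕ) (p r : Fin k → ℕ) (q s : ℕ)

theorem distMatrix_relaxedBlockStar_root (u : Unit) (x : Fin s × Fin 3) :
    distMatrix (relaxedBlockStar k p r q s) (inl u) (inr (inr (inr x))) = 1 := by
  simp only [distMatrix, Matrix.of_apply, relaxedBlockStar]
  rw [SimpleGraph.dist_eq_one_iff_adj.mpr (graphJoin_adj_inl_inr _ _ _ _), Nat.cast_one]

theorem distMatrix_relaxedBlockStar_clique (y : (i : Fin k) × (Fin (p i) × Fin (r i)))
    (x : Fin s × Fin 3) :
    distMatrix (relaxedBlockStar k p r q s) (inr (inl y)) (inr (inr (inr x))) = 2 := by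
  simp only [distMatrix, Matrix.of_apply, relaxedBlockStar]
  rw [graphJoin_dist_inr_of_not_adj _ (by simp) (graphSum_not_adj_inl_inr _ _ _ _),
    Nat.cast_ofNat]

theorem distMatrix_relaxedBlockStar_paw (y : Fin q × Fin 4) (x : Fin s × Fin 3) :
    distMatrix (relaxedBlockStar k p r q s) (inr (inr (inl y))) (inr (inr (inr x))) = 2 := by
  simp only [distMatrix, Matrix.of_apply, relaxedBlockStar]
  rw [graphJoin_dist_inr_of_not_adj _ (by simp), Nat.cast_ofNat]
  rw [graphSum_adj_inr_inr]
  exact graphSum_not_adj_inl_inr _ _ _ _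

theorem distMatrix_relaxedBlockStar_path (i j : Fin s) (a b : Fin 3) :
    distMatrix (relaxedBlockStar k p r q s) (inr (inr (inr (i, a)))) (inr (inr (inr (j, b)))) =
      if i = j then path3Dist a b else 2 := by
  simp only [distMatrix, Matrix.of_apply, relaxedBlockStar]
  by_cases hij : i = j ∧ path3Dist a b = 1
  · rw [SimpleGraph.dist_eq_one_iff_adj.mpr, if_pos hij.1, hij.2, Nat.cast_one]
    rwa [graphJoin_adj_inr_inr, graphSum_adj_inr_inr, graphSum_adj_inr_inr, path3Copies_adj]
  · by_cases heq : i = j ∧ a = b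
    · obtain ⟨rfl, rfl⟩ := heq
      fin_cases a <;> simp [path3Dist]
    · rw [graphJoin_dist_inr_of_not_adj, Nat.cast_ofNat]
      · split_ifs with h
        · revert hij heq
          fin_cases a <;> fin_cases b <;> simp [path3Dist, h]
        · rfl
      · simpa using heq
      · rwa [graphSum_adj_inr_inr, graphSum_adj_inr_inr, path3Copies_adj]

end RelaxedBlockStar

/-- The basis `(1, 0, 1)`, `(0, 1, 0)`, written as columns, of the space of vectors on `P_3` that
are fixed by its reflection. -/
def path3Symm : Matrix (Fin 3) (Fin 2) ℝ := !![1, 0; 0, 1; 1, 0]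

/-- The action of the distance matrix of `P_3`, with every entry decreased by `2`, on the basis
`path3Symm`. -/
def path3Quotient : Matrix (Fin 2) (Fin 2) ℝ := !![-2, -1; -2, -2]

theorem charpoly_path3Quotient : path3Quotient.charpoly = X ^ 2 + 4 * X + 2 := by
  rw [Matrix.charpoly_fin_two, path3Quotient, Matrix.trace_fin_two_of, Matrix.det_fin_two_of]
  norm_num [map_ofNat (C : ℝ →+* ℝ[X])]

theorem path3Dist_sub_two_mul_path3Symm (a : Fin 3) (c : Fin 2) :
    ∑ b, (path3Dist a b - 2) * path3Symm b c = (path3Symm * path3Quotient) a c := by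
  fin_cases a <;> fin_cases c <;>
    simp [path3Dist, path3Symm, path3Quotient, Matrix.mul_apply, Fin.sum_univ_three,
      Fin.sum_univ_two] <;> norm_num

/-- The column `(c, j)` is the `c`-th column of `path3Symm` placed on the copy `j + 1` of `P_3`,
minus the same vector placed on the copy `0`. -/
def path3Difference (α β γ : Type*) (t : ℕ) :
    Matrix (α ⊕ (β ⊕ (γ ⊕ (Fin (t + 1) × Fin 3)))) (Fin 2 × Fin t) ℝ :=
  Matrix.of fun x y => match x with
    | inr (inr (inr z)) =>
      ((if z.1 = y.2.succ then 1 else 0) - if z.1 = 0 then 1 else 0) * path3Symm z.2 y.1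
    | _ => 0

/-- A left inverse of `path3Difference`. -/
def path3DifferenceInv (α β γ : Type*) (t : ℕ) :
    Matrix (Fin 2 × Fin t) (α ⊕ (β ⊕ (γ ⊕ (Fin (t + 1) × Fin 3)))) ℝ :=
  Matrix.of fun y x => match x with
    | inr (inr (inr z)) => if z = (y.2.succ, y.1.castSucc) then 1 else 0
    | _ => 0

section Difference

variable {α β γ : Type*} [Fintype α] [Fintype β] [Fintype γ] (t : ℕ)

theorem path3DifferenceInv_mul_path3Difference :
    path3DifferenceInv α β γ t * path3Difference α β γ t = 1 := by
  ext ⟨c, j⟩ ⟨d, l⟩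
  rw [Matrix.mul_apply]
  simp only [path3DifferenceInv, path3Difference, Matrix.of_apply, Fintype.sum_sum_type,
    zero_mul, Finset.sum_const_zero, zero_add, ite_mul, one_mul, Finset.sum_ite_eq',
    Finset.mem_univ, if_true, Fin.succ_ne_zero, if_false, sub_zero,
    Fin.succ_inj, Matrix.one_apply, Prod.mk.injEq]
  fin_cases c <;> fin_cases d <;> simp [path3Symm]

theorem mul_path3Difference {m : Type*}
    (A : Matrix m (α ⊕ (β ⊕ (γ ⊕ (Fin (t + 1) × Fin 3)))) ℝ) (x : m) (c : Fin 2) (j : Fin t) :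
    (A * path3Difference α β γ t) x (c, j) =
      ∑ b, (A x (inr (inr (inr (j.succ, b)))) - A x (inr (inr (inr (0, b))))) *
        path3Symm b c := by
  rw [Matrix.mul_apply]
  simp only [path3Difference, Matrix.of_apply, Fintype.sum_sum_type, Fintype.sum_prod_type,
    mul_zero, Finset.sum_const_zero, zero_add]
  rw [Finset.sum_comm]
  refine Finset.sum_congr rfl fun b _ => ?_
  simp [mul_sub, sub_mul, Finset.sum_sub_distrib]

end Difference

theorem distMatrix_relaxedBlockStar_mul_path3Difference (k : ℕ) (p r : Fin k → ℕ) (q t : ℕ) :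
    distMatrix (relaxedBlockStar k p r q (t + 1)) *
        path3Difference Unit ((i : Fin k) × (Fin (p i) × Fin (r i))) (Fin q × Fin 4) t =
      path3Difference Unit ((i : Fin k) × (Fin (p i) × Fin (r i))) (Fin q × Fin 4) t *
        Matrix.blockDiagonal fun _ : Fin t => path3Quotient := by
  ext x ⟨c, j⟩
  rw [mul_path3Difference]
  rcases x with x | x | x | ⟨i, a⟩
  · simp [distMatrix_relaxedBlockStar_root, path3Difference, Matrix.mul_apply]
  · simp [distMatrix_relaxedBlockStar_clique, path3Difference, Matrix.mul_apply]
  · simp [distMatrix_relaxedBlockStar_paw, path3Difference, Matrix.mul_apply]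
  · have hL : ∀ b, distMatrix (relaxedBlockStar k p r q (t + 1)) (inr (inr (inr (i, a))))
          (inr (inr (inr (j.succ, b)))) - distMatrix (relaxedBlockStar k p r q (t + 1))
          (inr (inr (inr (i, a)))) (inr (inr (inr (0, b)))) =
        ((if i = j.succ then 1 else 0) - if i = 0 then 1 else 0) * (path3Dist a b - 2) := by
      intro b
      rw [distMatrix_relaxedBlockStar_path, distMatrix_relaxedBlockStar_path]
      split_ifs <;> ring
    simp only [hL, mul_assoc]
    rw [← Finset.mul_sum, path3Dist_sub_two_mul_path3Symm, Matrix.mul_apply, Matrix.mul_apply,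
      Fintype.sum_prod_type, Finset.mul_sum]
    refine Finset.sum_congr rfl fun d _ => ?_
    simp [path3Difference, Matrix.blockDiagonal_apply, mul_assoc]


/-- For a relaxed block star with `s ≥ 2` copies of `P_3`, `(x² + 4x + 2)^(s-1)`
divides the characteristic polynomial of its distance matrix; moreover both roots
of `x² + 4x + 2` are less than `-1/2`. -/
theorem stmt_15 (k : ℕ) (p r : Fin k → ℕ) (q s : ℕ) (hk : 0 < k)
    (hp : ∀ i, 0 < p i) (hr : ∀ i, 0 < r i) (hq : 0 < q) (hs : 2 ≤ s) :
    ((X ^ 2 + 4 * X + 2 : Polynomial ℝ) ^ (s - 1) ∣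
      (distMatrix (relaxedBlockStar k p r q s)).charpoly) ∧
    (∀ x : ℝ, x ^ 2 + 4 * x + 2 = 0 → x < -1/2) := by
  refine ⟨?_, fun x hx => by nlinarith⟩
  obtain ⟨t, rfl⟩ : ∃ t, s = t + 1 := ⟨s - 1, by omega⟩
  have hdvd := Matrix.charpoly_dvd_X_pow_mul_charpoly
    (distMatrix_relaxedBlockStar_mul_path3Difference k p r q t)
    (path3DifferenceInv_mul_path3Difference t)
  rw [Matrix.charpoly_blockDiagonal, Finset.prod_const, Finset.card_univ, Fintype.card_fin,
    charpoly_path3Quotient] at hdvd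
  rw [Nat.add_sub_cancel]
  refine IsCoprime.dvd_of_dvd_mul_left (IsCoprime.pow ?_) hdvd
  refine ⟨C (1 / 2), -C (1 / 2) * (X + 4), ?_⟩
  have h2 : (C (1 / 2) * 2 : ℝ[X]) = 1 := by
    rw [← C_ofNat, ← C_mul]
    norm_num
  linear_combination h2
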